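/- (Remark 3.3) Assume (h1), (h2), (h3) and let f satisfy (f1)–(f4). Then d_∞ := inf_{u ∈ N} J(u) satisfies d_∞ = inf{ sup_{t > 0} J(t u) : u ∈ X, u not a.e. zero } and d_∞ > 0. -/

import Mathlib

open MeasureTheory Filter

noncomputable section

namespace ZeroMass

/-- The ambient Euclidean space `ℝ^N`. -/
abbrev EN (N : ℕ) := EuclideanSpace ℝ (Fin N)

/-- The critical fractional Sobolev exponent `2*_α = 2N/(N-2α)`. -/
def critExp (N : ℕ) (α : ℝ) : ℝ := 2 * N / (N - 2 * α)

/-- The square of the Gagliardo seminorm `[u]²`. -/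
def gagSq (N : ℕ) (α : ℝ) (u : EN N → ℝ) : ENNReal :=
  ∫⁻ p : EN N × EN N, ENNReal.ofReal ((u p.1 - u p.2) ^ 2 / ‖p.1 - p.2‖ ^ ((N : ℝ) + 2 * α))

/-- The square of the full norm `‖u‖² = [u]² + ∫ V u²`. -/
def normSq {N : ℕ} (α : ℝ) (V : EN N → ℝ) (u : EN N → ℝ) : ENNReal :=
  gagSq N α u + ∫⁻ x, ENNReal.ofReal (V x * u x ^ 2)

/-- Membership in the space `X`. -/
def memX {N : ℕ} (α : ℝ) (V : EN N → ℝ) (u : EN N → ℝ) : Prop :=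
  Measurable u ∧ normSq α V u < ⊤

/-- The norm of `X`, i.e. `‖u‖ = ([u]² + ∫ V u²)^{1/2}`. -/
def Xnorm {N : ℕ} (α : ℝ) (V : EN N → ℝ) (u : EN N → ℝ) : ℝ :=
  ((normSq α V u).toReal) ^ (1 / 2 : ℝ)

/-- The primitive `F(t) = ∫₀ᵗ f(τ) dτ`. -/
def prim (f : ℝ → ℝ) (t : ℝ) : ℝ := ∫ τ in (0 : ℝ)..t, f τ

/-- The energy functional `J`. -/
def Jfun {N : ℕ} (α : ℝ) (V K : EN N → ℝ) (f : ℝ → ℝ) (u : EN N → ℝ) : ℝ :=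
  (1 / 2) * (normSq α V u).toReal - ∫ x, K x * prim f (u x)

/-- The pairing `⟨J'(u), φ⟩`. -/
def Jd {N : ℕ} (α : ℝ) (V K : EN N → ℝ) (f : ℝ → ℝ) (u φ : EN N → ℝ) : ℝ :=
  (∫ p : EN N × EN N, (u p.1 - u p.2) * (φ p.1 - φ p.2) / ‖p.1 - p.2‖ ^ ((N : ℝ) + 2 * α))
    + (∫ x, V x * u x * φ x) - ∫ x, K x * f (u x) * φ x

/-- Positive part `u⁺ = max(u, 0)`. -/
def uplus {N : ℕ} (u : EN N → ℝ) : EN N → ℝ := fun x => max (u x) 0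

/-- Negative part `u⁻ = min(u, 0)`. -/
def uminus {N : ℕ} (u : EN N → ℝ) : EN N → ℝ := fun x => min (u x) 0

/-- `u` is not almost everywhere zero. -/
def NotAEZero {N : ℕ} (u : EN N → ℝ) : Prop :=
  ¬ (u =ᵐ[(volume : Measure (EN N))] (0 : EN N → ℝ))

/-- Hypothesis (h1): `V, K > 0` everywhere and `K` bounded. -/
def H1 {N : ℕ} (V K : EN N → ℝ) : Prop :=
  (∀ x, 0 < V x) ∧ (∀ x, 0 < K x) ∧ ∃ C : ℝ, ∀ x, K x ≤ C

/-- Hypothesis (h2): uniform vanishing of `∫_{A_n ∩ {|x| ≥ r}} K`. -/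
def H2 {N : ℕ} (K : EN N → ℝ) : Prop :=
  ∀ (A : ℕ → Set (EN N)) (R : ℝ), 0 < R → (∀ n, MeasurableSet (A n)) →
    (∀ n, volume (A n) ≤ ENNReal.ofReal R) →
    ∀ ε : ℝ, 0 < ε → ∃ r₀ : ℝ, ∀ r : ℝ, r₀ ≤ r → ∀ n,
      (∫⁻ x in A n ∩ {x : EN N | r ≤ ‖x‖}, ENNReal.ofReal (K x)) ≤ ENNReal.ofReal ε

/-- Hypothesis (h3): `K/V` is bounded. -/
def H3 {N : ℕ} (V K : EN N → ℝ) : Prop := ∃ C : ℝ, ∀ x, K x / V x ≤ C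

/-- Hypothesis (h4) with exponent `m`. -/
def H4 {N : ℕ} (α : ℝ) (V K : EN N → ℝ) (m : ℝ) : Prop :=
  2 < m ∧ m < critExp N α ∧
    Tendsto (fun x : EN N => K x / V x ^ ((critExp N α - m) / (critExp N α - 2)))
      (comap (fun x : EN N => ‖x‖) atTop) (nhds 0)

/-- Hypothesis (f1): `f(t)/|t| → 0` as `t → 0`. -/
def Cf1 (f : ℝ → ℝ) : Prop :=
  Tendsto (fun t : ℝ => f t / |t|) (nhdsWithin 0 {(0 : ℝ)}ᶜ) (nhds 0)

/-- Hypothesis (f̃1): `limsup_{t→0} f(t)/|t|^{m-1} < ∞`. -/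
def Cf1' (f : ℝ → ℝ) (m : ℝ) : Prop :=
  ∃ C : ℝ, ∀ᶠ t in nhdsWithin (0 : ℝ) {(0 : ℝ)}ᶜ, f t / |t| ^ (m - 1) ≤ C

/-- Hypothesis (f2) with exponent `p`: `f(t)/|t|^{p-1} → 0` as `|t| → ∞`. -/
def Cf2 (f : ℝ → ℝ) (p : ℝ) : Prop :=
  Tendsto (fun t : ℝ => f t / |t| ^ (p - 1)) (comap (fun t : ℝ => |t|) atTop) (nhds 0)

/-- Hypothesis (f3): `F(t)/t² → +∞` as `|t| → ∞`. -/
def Cf3 (f : ℝ → ℝ) : Prop :=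
  Tendsto (fun t : ℝ => prim f t / t ^ 2) (comap (fun t : ℝ => |t|) atTop) atTop

/-- Hypothesis (f4): `t ↦ f(t)/|t|` is strictly increasing on `ℝ \ {0}`. -/
def Cf4 (f : ℝ → ℝ) : Prop :=
  ∀ s t : ℝ, s ≠ 0 → t ≠ 0 → s < t → f s / |s| < f t / |t|

/-- Nehari manifold membership, formulated with the pairing `⟨J'(u), u⟩ = 0`. -/
def memNehari {N : ℕ} (α : ℝ) (V K : EN N → ℝ) (f : ℝ → ℝ) (u : EN N → ℝ) : Prop :=
  memX α V u ∧ NotAEZero u ∧ Jd α V K f u u = 0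

/-- Nehari manifold membership, formulated as `‖u‖² = ∫ K f(u) u`. -/
def memNehari2 {N : ℕ} (α : ℝ) (V K : EN N → ℝ) (f : ℝ → ℝ) (u : EN N → ℝ) : Prop :=
  memX α V u ∧ NotAEZero u ∧ (normSq α V u).toReal = ∫ x, K x * f (u x) * u x

/-- Nodal (sign-changing) Nehari set membership. -/
def memM {N : ℕ} (α : ℝ) (V K : EN N → ℝ) (f : ℝ → ℝ) (u : EN N → ℝ) : Prop :=
  memNehari α V K f u ∧ NotAEZero (uplus u) ∧ NotAEZero (uminus u) ∧
    Jd α V K f u (uplus u) = 0 ∧ Jd α V K f u (uminus u) = 0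

/-- Weak convergence in `X` of the sequence `u` to `w`. -/
def weakConv {N : ℕ} (α : ℝ) (V : EN N → ℝ) (u : ℕ → EN N → ℝ) (w : EN N → ℝ) : Prop :=
  ∀ v : EN N → ℝ, memX α V v →
    Tendsto (fun n =>
      (∫ p : EN N × EN N,
        ((u n p.1 - w p.1) - (u n p.2 - w p.2)) * (v p.1 - v p.2)
          / ‖p.1 - p.2‖ ^ ((N : ℝ) + 2 * α))
      + ∫ x, V x * (u n x - w x) * v x) atTop (nhds 0)

end ZeroMass

open ZeroMass

namespace ZeroMass

/-- Jensen's inequality for the square of a set average. -/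
theorem sq_setAverage_sub_mul_le {X : Type*} [MeasurableSpace X] {μ : Measure X} {A : Set X}
    (hA0 : μ A ≠ 0) (hA : μ A ≠ ⊤) {g : X → ℝ} (hg : IntegrableOn g A μ) (c : ℝ) :
    ENNReal.ofReal (((⨍ x in A, g x ∂μ) - c) ^ 2) * μ A
      ≤ ∫⁻ x in A, ENNReal.ofReal ((g x - c) ^ 2) ∂μ := by
  by_cases htop : ∫⁻ x in A, ENNReal.ofReal ((g x - c) ^ 2) ∂μ = ⊤
  · rw [htop]; exact le_top
  have hgc : IntegrableOn (fun x => g x - c) A μ := hg.sub (integrableOn_const hA)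
  have hsq : IntegrableOn (fun x => (g x - c) ^ 2) A μ :=
    (lintegral_ofReal_ne_top_iff_integrable (hgc.aestronglyMeasurable.pow 2)
      (ae_of_all _ fun x => sq_nonneg _)).1 htop
  have hpos : 0 < μ.real A := ENNReal.toReal_pos hA0 hA
  have hJ := (even_two.convexOn_pow (𝕜 := ℝ)).map_set_average_le (μ := μ) (t := A)
    (f := fun x => g x - c) (by fun_prop) isClosed_univ hA0 hA (by simp) hgc hsq
  have hav : (⨍ x in A, (g x - c) ∂μ) = (⨍ x in A, g x ∂μ) - c := by
    rw [setAverage_eq, setAverage_eq, integral_sub hg (integrableOn_const hA)]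
    simp only [integral_const, smul_eq_mul, measureReal_restrict_apply_univ]
    field_simp
  rw [hav, setAverage_eq _ fun x => (g x - c) ^ 2, smul_eq_mul, inv_mul_eq_div, le_div_iff₀ hpos] at hJ
  rw [← ofReal_integral_eq_lintegral_ofReal hsq (ae_of_all _ fun x => sq_nonneg _),
    ← ENNReal.ofReal_toReal hA, ← ENNReal.ofReal_mul (sq_nonneg _)]
  exact ENNReal.ofReal_le_ofReal hJ

/-- The pointwise Gagliardo energy density of `u` at `x`. -/
def gagDensity {N : ℕ} (α : ℝ) (u : EN N → ℝ) (x : EN N) : ENNReal :=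
  ∫⁻ y, ENNReal.ofReal ((u x - u y) ^ 2 / ‖x - y‖ ^ ((N : ℝ) + 2 * α))

theorem measurable_gagKernel {N : ℕ} (α : ℝ) {u : EN N → ℝ} (hu : Measurable u) :
    Measurable fun p : EN N × EN N =>
      ENNReal.ofReal ((u p.1 - u p.2) ^ 2 / ‖p.1 - p.2‖ ^ ((N : ℝ) + 2 * α)) := by
  fun_prop

theorem lintegral_gagDensity {N : ℕ} (α : ℝ) {u : EN N → ℝ} (hu : Measurable u) :
    ∫⁻ x, gagDensity α u x = gagSq N α u := by
  unfold gagDensity gagSq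
  rw [Measure.volume_eq_prod, lintegral_prod _ (measurable_gagKernel α hu).aemeasurable]

theorem measurable_gagDensity {N : ℕ} (α : ℝ) {u : EN N → ℝ} (hu : Measurable u) :
    Measurable (gagDensity α u) :=
  (measurable_gagKernel α hu).lintegral_prod_right'

theorem setLIntegral_sq_sub_le {N : ℕ} {α D : ℝ} (hα : 0 < α) {u : EN N → ℝ} {B : Set (EN N)}
    (hB : MeasurableSet B) (x : EN N) (hD : ∀ y ∈ B, ‖x - y‖ ≤ D) (hD0 : 0 ≤ D) :
    ∫⁻ y in B, ENNReal.ofReal ((u y - u x) ^ 2)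
      ≤ ENNReal.ofReal (D ^ ((N : ℝ) + 2 * α)) * gagDensity α u x := by
  have hexp : (N : ℝ) + 2 * α ≠ 0 := by positivity
  unfold gagDensity
  rw [← lintegral_const_mul' _ _ ENNReal.ofReal_ne_top]
  refine le_trans (setLIntegral_mono' hB fun y hy => ?_) (setLIntegral_le_lintegral B _)
  rw [← ENNReal.ofReal_mul (by positivity)]
  apply ENNReal.ofReal_le_ofReal
  rcases eq_or_ne x y with rfl | hxy
  · simp
  · have hn : 0 < ‖x - y‖ := norm_pos_iff.2 (sub_ne_zero.2 hxy)
    have h1 : ‖x - y‖ ^ ((N : ℝ) + 2 * α) ≤ D ^ ((N : ℝ) + 2 * α) :=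
      Real.rpow_le_rpow hn.le (hD y hy) (by positivity)
    have h2 : 0 < ‖x - y‖ ^ ((N : ℝ) + 2 * α) := by positivity
    rw [← mul_div_assoc, le_div_iff₀ h2]
    nlinarith [mul_le_mul_of_nonneg_right h1 (sq_nonneg (u x - u y))]

theorem sq_setAverage_sub_self_mul_le {N : ℕ} {α D : ℝ} (hα : 0 < α) {u : EN N → ℝ}
    {B : Set (EN N)} (hB : MeasurableSet B) (hB0 : volume B ≠ 0) (hBt : volume B ≠ ⊤)
    (huB : IntegrableOn u B) (x : EN N) (hD : ∀ y ∈ B, ‖x - y‖ ≤ D) (hD0 : 0 ≤ D) :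
    ENNReal.ofReal ((u x - ⨍ y in B, u y) ^ 2) * volume B
      ≤ ENNReal.ofReal (D ^ ((N : ℝ) + 2 * α)) * gagDensity α u x := by
  refine le_trans ?_ (setLIntegral_sq_sub_le hα hB x hD hD0)
  rw [← neg_sq, neg_sub]
  exact sq_setAverage_sub_mul_le hB0 hBt huB (u x)

theorem sq_setAverage_sub_setAverage_mul_le {N : ℕ} {α D : ℝ} (hα : 0 < α) {u : EN N → ℝ}
    (hu : Measurable u) {A B : Set (EN N)} (hA : MeasurableSet A) (hA0 : volume A ≠ 0)
    (hAt : volume A ≠ ⊤) (huA : IntegrableOn u A) (hB : MeasurableSet B) (hB0 : volume B ≠ 0)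
    (hBt : volume B ≠ ⊤) (huB : IntegrableOn u B)
    (hD : ∀ x ∈ A, ∀ y ∈ B, ‖x - y‖ ≤ D) (hD0 : 0 ≤ D) :
    ENNReal.ofReal (((⨍ x in A, u x) - ⨍ y in B, u y) ^ 2) * (volume A * volume B)
      ≤ ENNReal.ofReal (D ^ ((N : ℝ) + 2 * α)) * gagSq N α u := by
  calc _ ≤ (∫⁻ x in A, ENNReal.ofReal ((u x - ⨍ y in B, u y) ^ 2)) * volume B := by
        rw [← mul_assoc]
        gcongr
        exact sq_setAverage_sub_mul_le hA0 hAt huA _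
    _ = ∫⁻ x in A, ENNReal.ofReal ((u x - ⨍ y in B, u y) ^ 2) * volume B :=
        (lintegral_mul_const' _ _ hBt).symm
    _ ≤ ∫⁻ x in A, ENNReal.ofReal (D ^ ((N : ℝ) + 2 * α)) * gagDensity α u x :=
        setLIntegral_mono' hA fun x hx =>
          sq_setAverage_sub_self_mul_le hα hB hB0 hBt huB x (hD x hx) hD0
    _ ≤ ∫⁻ x, ENNReal.ofReal (D ^ ((N : ℝ) + 2 * α)) * gagDensity α u x :=
        setLIntegral_le_lintegral _ _
    _ = _ := by
        rw [lintegral_const_mul' _ _ ENNReal.ofReal_ne_top, lintegral_gagDensity α hu]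

theorem volume_ball_eq {N : ℕ} (x : EN N) {r : ℝ} (hr : 0 < r) :
    volume (Metric.ball x r)
      = ENNReal.ofReal (r ^ N * (volume (Metric.ball (0 : EN N) 1)).toReal) := by
  rw [Measure.addHaar_ball_of_pos _ _ hr, finrank_euclideanSpace_fin,
    ENNReal.ofReal_mul (by positivity), ENNReal.ofReal_toReal measure_ball_lt_top.ne]

theorem volume_unitBall_pos (N : ℕ) : 0 < (volume (Metric.ball (0 : EN N) 1)).toReal :=
  ENNReal.toReal_pos (Metric.measure_ball_pos _ _ one_pos).ne' measure_ball_lt_top.ne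

/-- A function is close to its average on a ball, in terms of the Gagliardo density. -/
theorem sq_sub_ballAverage_le {N : ℕ} {α : ℝ} (hα : 0 < α) {u : EN N → ℝ} {x : EN N} {r : ℝ}
    (hr : 0 < r) (huB : IntegrableOn u (Metric.ball x r)) (hx : gagDensity α u x ≠ ⊤) :
    (u x - ⨍ y in Metric.ball x r, u y) ^ 2
      ≤ (volume (Metric.ball (0 : EN N) 1)).toReal⁻¹ * r ^ (2 * α) * (gagDensity α u x).toReal := by
  have h := sq_setAverage_sub_self_mul_le (D := r) hα (measurableSet_ball (x := x) (ε := r))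
    (Metric.measure_ball_pos _ _ hr).ne' measure_ball_lt_top.ne huB x
    (fun y hy => by rw [← dist_eq_norm, dist_comm]; exact (Metric.mem_ball.1 hy).le) hr.le
  have hω := volume_unitBall_pos N
  set ω := (volume (Metric.ball (0 : EN N) 1)).toReal
  rw [volume_ball_eq _ hr, ← ENNReal.ofReal_toReal hx, ← ENNReal.ofReal_mul (by positivity),
    ← ENNReal.ofReal_mul (by positivity), ENNReal.ofReal_le_ofReal_iff (by positivity),
    Real.rpow_add hr, Real.rpow_natCast] at h
  have hrN : 0 < r ^ N := by positivity
  rw [mul_assoc, inv_mul_eq_div, le_div_iff₀ hω]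
  refine le_of_mul_le_mul_left ?_ hrN
  linarith

/-- Averages on two balls are close, in terms of the Gagliardo seminorm. -/
theorem sq_ballAverage_sub_ballAverage_le {N : ℕ} {α D : ℝ} (hα : 0 < α) {u : EN N → ℝ}
    (hu : Measurable u) (huI : ∀ x r, IntegrableOn u (Metric.ball x r)) (hG : gagSq N α u ≠ ⊤)
    {x y : EN N} {r s : ℝ} (hr : 0 < r) (hs : 0 < s)
    (hD : ‖x - y‖ + r + s ≤ D) :
    ((⨍ z in Metric.ball x r, u z) - ⨍ z in Metric.ball y s, u z) ^ 2
      ≤ D ^ ((N : ℝ) + 2 * α) * (gagSq N α u).toReal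
        / (r ^ N * s ^ N * (volume (Metric.ball (0 : EN N) 1)).toReal ^ 2) := by
  have hD0 : 0 ≤ D := by linarith [norm_nonneg (x - y)]
  have h := sq_setAverage_sub_setAverage_mul_le (D := D) hα hu
    (measurableSet_ball (x := x) (ε := r))
    (Metric.measure_ball_pos _ _ hr).ne' measure_ball_lt_top.ne (huI _ _)
    (measurableSet_ball (x := y) (ε := s))
    (Metric.measure_ball_pos _ _ hs).ne' measure_ball_lt_top.ne (huI _ _)
    (fun a ha b hb => by
      have h1 : ‖a - x‖ < r := by rw [← dist_eq_norm]; exact ha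
      have h2 : ‖b - y‖ < s := by rw [← dist_eq_norm]; exact hb
      have h3 : ‖a - b‖ ≤ ‖a - x‖ + ‖x - y‖ + ‖b - y‖ := by
        rw [← norm_neg (b - y), show a - b = a - x + (x - y) + -(b - y) by abel]
        exact norm_add₃_le
      linarith) hD0
  have hω := volume_unitBall_pos N
  rw [volume_ball_eq _ hr, volume_ball_eq _ hs] at h
  set ω := (volume (Metric.ball (0 : EN N) 1)).toReal
  rw [← ENNReal.ofReal_toReal hG, ← ENNReal.ofReal_mul (by positivity),
    ← ENNReal.ofReal_mul (by positivity), ← ENNReal.ofReal_mul (by positivity),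
    ENNReal.ofReal_le_ofReal_iff (by positivity)] at h
  rw [le_div_iff₀ (by positivity)]
  linarith

theorem abs_ballAverage_sub_ballAverage_le {N : ℕ} {α M ρ : ℝ} (hα : 0 < α) {u : EN N → ℝ}
    (hu : Measurable u) (huI : ∀ x r, IntegrableOn u (Metric.ball x r)) (hG : gagSq N α u ≠ ⊤)
    {x y : EN N} {r s : ℝ} (hr : 0 < r) (hs : 0 < s) (hρ : 0 < ρ)
    (hM : ‖x - y‖ + ρ * r + ρ * s ≤ ρ * M) :
    |(⨍ z in Metric.ball x (ρ * r), u z) - ⨍ z in Metric.ball y (ρ * s), u z|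
      ≤ √(M ^ ((N : ℝ) + 2 * α) / (r ^ N * s ^ N * (volume (Metric.ball (0 : EN N) 1)).toReal ^ 2)
        * (gagSq N α u).toReal) * ρ ^ (α - N / 2) := by
  have hM0 : 0 ≤ M := by
    have : 0 ≤ ρ * M := le_trans (by positivity) hM
    exact nonneg_of_mul_nonneg_right this hρ
  have h := sq_ballAverage_sub_ballAverage_le hα hu huI hG (mul_pos hρ hr) (mul_pos hρ hs) hM
  have hω := volume_unitBall_pos N
  set ω := (volume (Metric.ball (0 : EN N) 1)).toReal
  refine abs_le_of_sq_le_sq (h.trans (le_of_eq ?_)) (by positivity)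
  rw [mul_pow (√_), Real.sq_sqrt (by positivity), Real.mul_rpow hρ.le hM0, ← Real.rpow_natCast (ρ ^ _),
    ← Real.rpow_mul hρ.le]
  have e : ρ ^ ((N : ℝ) + 2 * α) = ρ ^ ((α - N / 2) * (2 : ℕ)) * (ρ ^ N * ρ ^ N) := by
    rw [← Real.rpow_natCast, ← Real.rpow_add hρ, ← Real.rpow_add hρ]
    congr 1; push_cast; ring
  rw [e, mul_pow, mul_pow]
  field_simp

/-- Ball averages of a function with finite Gagliardo seminorm converge to a single constant as
the radius grows, with a uniform rate. -/
theorem exists_abs_ballAverage_sub_le {N : ℕ} {α : ℝ} (hα : 0 < α) (hN : 2 * α < N) :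
    ∃ C : ℝ, 0 ≤ C ∧ ∀ u : EN N → ℝ, Measurable u → (∀ x r, IntegrableOn u (Metric.ball x r)) →
      gagSq N α u ≠ ⊤ → ∃ c : ℝ, ∀ x r, 0 < r →
        |(⨍ z in Metric.ball x r, u z) - c| ≤ C * √(gagSq N α u).toReal * r ^ (α - N / 2) := by
  set ω := (volume (Metric.ball (0 : EN N) 1)).toReal with hω
  set q : ℝ := 2 ^ (α - N / 2) with hq
  have hq0 : 0 < q := by positivity
  have hq1 : q < 1 := Real.rpow_lt_one_of_one_lt_of_neg (by norm_num) (by linarith)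
  have hpow : ∀ (r : ℝ), 0 < r → ∀ k : ℕ, (2 ^ k * r) ^ (α - N / 2) = r ^ (α - N / 2) * q ^ k := by
    intro r hr k
    rw [Real.mul_rpow (by positivity) hr.le, ← Real.rpow_natCast, ← Real.rpow_mul (by norm_num),
      mul_comm (k : ℝ), Real.rpow_mul (by norm_num), Real.rpow_natCast, mul_comm]
  set A : ℝ := √(3 ^ ((N : ℝ) + 2 * α) / (1 ^ N * 2 ^ N * ω ^ 2))
  refine ⟨A / (1 - q), div_nonneg (by positivity) (by linarith), fun u hu huI hG => ?_⟩
  set G := (gagSq N α u).toReal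
  have hstep : ∀ x : EN N, ∀ r : ℝ, 0 < r → ∀ k : ℕ,
      dist (⨍ z in Metric.ball x (2 ^ k * r), u z) (⨍ z in Metric.ball x (2 ^ (k + 1) * r), u z)
        ≤ A * √G * r ^ (α - N / 2) * q ^ k := by
    intro x r hr k
    have h := abs_ballAverage_sub_ballAverage_le (x := x) (y := x) (r := 1) (s := 2)
      (ρ := 2 ^ k * r) (M := 3) hα hu huI hG one_pos two_pos (by positivity)
      (by simp only [sub_self, norm_zero]; linarith)
    rw [Real.dist_eq]
    convert h using 1
    · rw [pow_succ]; congr 5 <;> ring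
    · rw [hpow r hr k, Real.sqrt_mul (by positivity)]; ring
  have hcs := cauchySeq_of_le_geometric _ _ hq1 (hstep 0 1 one_pos)
  obtain ⟨c, hc⟩ := cauchySeq_tendsto_of_complete hcs
  refine ⟨c, fun x r hr => ?_⟩
  have hcx : Tendsto (fun k : ℕ => ⨍ z in Metric.ball x (2 ^ k * r), u z) atTop (nhds c) := by
    have hd : Tendsto (fun k : ℕ => (⨍ z in Metric.ball x (2 ^ k * r), u z)
        - ⨍ z in Metric.ball 0 (2 ^ k * 1), u z) atTop (nhds 0) := by
      refine squeeze_zero_norm (a := fun k : ℕ => √((‖x‖ + r + 1) ^ ((N : ℝ) + 2 * α)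
        / (r ^ N * 1 ^ N * ω ^ 2) * G) * q ^ k) (fun k => ?_) ?_
      · have h := abs_ballAverage_sub_ballAverage_le (x := x) (y := 0) (r := r) (s := 1)
          (ρ := 2 ^ k) (M := ‖x‖ + r + 1) hα hu huI hG hr one_pos (by positivity) (by
            have : (1 : ℝ) ≤ 2 ^ k := one_le_pow₀ (by norm_num)
            rw [sub_zero]
            nlinarith [norm_nonneg x])
        have e := hpow 1 one_pos k
        rw [mul_one, Real.one_rpow, one_mul] at e
        rw [e] at h
        exact h
      · simpa using (tendsto_pow_atTop_nhds_zero_of_lt_one hq0.le hq1).const_mul _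
    simpa using hd.add hc
  have h := dist_le_of_le_geometric_of_tendsto₀ _ _ hq1 (hstep x r hr) hcx
  rw [Real.dist_eq, pow_zero, one_mul] at h
  convert h using 1
  ring

theorem le_of_forall_pos_le_rpow_add {s d a G C T : ℝ} (hs : 0 < s) (hsd : s < d)
    (ha : 0 ≤ a) (hG : 0 ≤ G)
    (h : ∀ r : ℝ, 0 < r → T ≤ C * (r ^ s * a + r ^ (s - d) * G)) (hC : 0 ≤ C) :
    T ≤ 2 * C * (a ^ (1 - s / d) * G ^ (s / d)) := by
  have hd : 0 < d := hs.trans hsd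
  have key : ∀ δ : ℝ, 0 < δ → T ≤ 2 * C * ((a + δ) ^ (1 - s / d) * (G + δ) ^ (s / d)) := by
    intro δ hδ
    have ha' : 0 < a + δ := by linarith
    have hG' : 0 < G + δ := by linarith
    set x := a + δ
    set y := G + δ
    have hr : 0 < (y / x) ^ (1 / d) := by positivity
    refine (h _ hr).trans ?_
    have e1 : ((y / x) ^ (1 / d)) ^ s * x = x ^ (1 - s / d) * y ^ (s / d) := by
      rw [← Real.rpow_mul (by positivity), Real.div_rpow hG'.le ha'.le, one_div_mul_eq_div,
        Real.rpow_sub ha', Real.rpow_one]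
      ring
    have e2 : ((y / x) ^ (1 / d)) ^ (s - d) * y = x ^ (1 - s / d) * y ^ (s / d) := by
      rw [← Real.rpow_mul (by positivity), Real.div_rpow hG'.le ha'.le,
        show 1 / d * (s - d) = s / d - 1 by field_simp, Real.rpow_sub ha', Real.rpow_sub ha',
        Real.rpow_sub hG', Real.rpow_one, Real.rpow_one]
      have := (Real.rpow_pos_of_pos ha' (s / d)).ne'
      field_simp
    have h1 : ((y / x) ^ (1 / d)) ^ s * a ≤ ((y / x) ^ (1 / d)) ^ s * x := by
      gcongr; linarith
    have h2 : ((y / x) ^ (1 / d)) ^ (s - d) * G ≤ ((y / x) ^ (1 / d)) ^ (s - d) * y := by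
      gcongr; linarith
    calc _ ≤ C * (x ^ (1 - s / d) * y ^ (s / d) + x ^ (1 - s / d) * y ^ (s / d)) := by
          exact mul_le_mul_of_nonneg_left (by linarith) hC
      _ = _ := by ring
  have h1 : 0 ≤ 1 - s / d := by
    rw [sub_nonneg, div_le_one hd]; exact hsd.le
  have h2 : 0 ≤ s / d := by positivity
  have hcont : Continuous fun δ : ℝ =>
      2 * C * ((a + δ) ^ (1 - s / d) * (G + δ) ^ (s / d)) := by
    refine continuous_const.mul (Continuous.mul ?_ ?_)
    · exact (continuous_const.add continuous_id).rpow_const fun _ => Or.inr h1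
    · exact (continuous_const.add continuous_id).rpow_const fun _ => Or.inr h2
  have hlim : Tendsto (fun δ : ℝ => 2 * C * ((a + δ) ^ (1 - s / d) * (G + δ) ^ (s / d)))
      (nhdsWithin 0 (Set.Ioi 0)) (nhds (2 * C * (a ^ (1 - s / d) * G ^ (s / d)))) := by
    have := (hcont.tendsto 0).mono_left (nhdsWithin_le_nhds (s := Set.Ioi 0))
    simpa using this
  exact ge_of_tendsto hlim (eventually_mem_nhdsWithin.mono key)

theorem two_lt_critExp {N : ℕ} {α : ℝ} (hα : 0 < α) (hN : 2 * α < N) : 2 < critExp N α := by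
  unfold critExp
  rw [lt_div_iff₀ (by linarith)]
  linarith

/-- The fractional Sobolev inequality modulo constants, together with control of the ball averages
by the subtracted constant. -/
theorem exists_lintegral_abs_sub_const_rpow_le {N : ℕ} {α : ℝ} (hα : 0 < α) (hN : 2 * α < N) :
    ∃ C : ℝ, 0 ≤ C ∧ ∀ u : EN N → ℝ, Measurable u → (∀ x r, IntegrableOn u (Metric.ball x r)) →
      gagSq N α u ≠ ⊤ → ∃ c : ℝ,
        |(⨍ z in Metric.ball 0 1, u z) - c| ≤ C * √(gagSq N α u).toReal ∧
        ∫⁻ x, ENNReal.ofReal (|u x - c| ^ critExp N α)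
          ≤ ENNReal.ofReal (C * (gagSq N α u).toReal ^ (critExp N α / 2)) := by
  obtain ⟨C₀, hC₀, hC⟩ := exists_abs_ballAverage_sub_le hα hN
  have hω := volume_unitBall_pos N
  set ω := (volume (Metric.ball (0 : EN N) 1)).toReal with hωdef
  have hN0 : (0 : ℝ) < N := by linarith
  set p := critExp N α with hp
  have hp2 : 2 < p := two_lt_critExp hα hN
  set C₁ : ℝ := 2 * (ω⁻¹ + C₀ ^ 2) with hC₁
  have hC₁0 : 0 ≤ C₁ := by positivity
  refine ⟨max C₀ ((2 * C₁) ^ (p / 2)), le_max_of_le_left hC₀, fun u hu huI hG => ?_⟩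
  obtain ⟨c, hc⟩ := hC u hu huI hG
  set G := (gagSq N α u).toReal with hGdef
  have hG0 : 0 ≤ G := ENNReal.toReal_nonneg
  refine ⟨c, ?_, ?_⟩
  · refine (hc 0 1 one_pos).trans ?_
    rw [Real.one_rpow, mul_one]
    gcongr
    exact le_max_left _ _
  have hfin : ∀ᵐ x, gagDensity α u x < ⊤ :=
    ae_lt_top (measurable_gagDensity α hu) (by rwa [lintegral_gagDensity α hu])
  have e1 : (1 - 2 * α / N) * (p / 2) = 1 := by
    rw [hp, critExp]
    have : (N : ℝ) - 2 * α ≠ 0 := by linarith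
    field_simp
  have e2 : 2 * α / N * (p / 2) + 1 = p / 2 := by linarith [e1]
  have hpt : ∀ᵐ x, ENNReal.ofReal (|u x - c| ^ p)
      ≤ ENNReal.ofReal ((2 * C₁) ^ (p / 2) * G ^ (2 * α / N * (p / 2))) * gagDensity α u x := by
    filter_upwards [hfin] with x hx
    set a := (gagDensity α u x).toReal with ha
    have ha0 : 0 ≤ a := ENNReal.toReal_nonneg
    have hb : (u x - c) ^ 2 ≤ 2 * C₁ * (a ^ (1 - 2 * α / N) * G ^ (2 * α / N)) := by
      refine le_of_forall_pos_le_rpow_add (by positivity) hN ha0 hG0 (fun r hr => ?_) hC₁0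
      have h1 := sq_sub_ballAverage_le hα hr (huI x r) hx.ne
      have h2 := hc x r hr
      set m := ⨍ y in Metric.ball x r, u y
      have h3 : (m - c) ^ 2 ≤ C₀ ^ 2 * (r ^ (2 * α - N) * G) := by
        rw [← sq_abs]
        refine (pow_le_pow_left₀ (abs_nonneg _) h2 2).trans (le_of_eq ?_)
        rw [mul_pow, mul_pow, Real.sq_sqrt hG0, ← Real.rpow_natCast (r ^ _),
          ← Real.rpow_mul hr.le, show (α - N / 2) * ((2 : ℕ) : ℝ) = 2 * α - N by push_cast; ring]
        ring
      have h4 : 0 ≤ C₀ ^ 2 * (r ^ (2 * α) * a) := by positivity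
      have h5 : 0 ≤ ω⁻¹ * (r ^ (2 * α - N) * G) := by positivity
      have h6 : (u x - c) ^ 2 ≤ 2 * (u x - m) ^ 2 + 2 * (m - c) ^ 2 := by
        nlinarith [sq_nonneg ((u x - m) - (m - c))]
      rw [hC₁]
      nlinarith
    rw [← ENNReal.ofReal_toReal hx.ne, ← ENNReal.ofReal_mul (by positivity)]
    apply ENNReal.ofReal_le_ofReal
    calc |u x - c| ^ p = ((u x - c) ^ 2) ^ (p / 2) := by
          rw [← sq_abs, ← Real.rpow_natCast, ← Real.rpow_mul (abs_nonneg _)]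
          congr 1; push_cast; ring
      _ ≤ (2 * C₁ * (a ^ (1 - 2 * α / N) * G ^ (2 * α / N))) ^ (p / 2) := by
          gcongr
      _ = _ := by
          rw [Real.mul_rpow (x := 2 * C₁) (by positivity) (by positivity),
            Real.mul_rpow (x := a ^ _) (by positivity) (by positivity), ← Real.rpow_mul ha0,
            ← Real.rpow_mul hG0, e1, Real.rpow_one]
          ring
  refine (lintegral_mono_ae hpt).trans ?_
  rw [lintegral_const_mul' _ _ ENNReal.ofReal_ne_top, lintegral_gagDensity α hu,
    ← ENNReal.ofReal_toReal hG, ← ENNReal.ofReal_mul (by positivity)]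
  apply ENNReal.ofReal_le_ofReal
  have e3 : G ^ (2 * α / N * (p / 2)) * G = G ^ (p / 2) := by
    conv_rhs => rw [← e2]
    rw [Real.rpow_add_of_nonneg hG0 (by positivity) zero_le_one, Real.rpow_one]
  rw [← hGdef, mul_assoc, e3]
  gcongr
  exact le_max_right _ _

section Weights

variable {N : ℕ} {α : ℝ} {V K : EN N → ℝ}

theorem gagSq_le_normSq (u : EN N → ℝ) : gagSq N α u ≤ normSq α V u := le_self_add

theorem lintegral_weight_le_normSq (u : EN N → ℝ) :
    ∫⁻ x, ENNReal.ofReal (V x * u x ^ 2) ≤ normSq α V u := le_add_self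

theorem exists_setLIntegral_ball_sq_le (hV : Continuous V) (hV0 : ∀ x, 0 < V x) (x : EN N)
    (r : ℝ) : ∃ C : ℝ, 0 ≤ C ∧ ∀ u : EN N → ℝ,
      ∫⁻ y in Metric.ball x r, ENNReal.ofReal (u y ^ 2) ≤ ENNReal.ofReal C * normSq α V u := by
  obtain ⟨v, hv, hle⟩ := (isCompact_closedBall x r).exists_forall_le' (a := 0)
    hV.continuousOn (fun y _ => hV0 y)
  refine ⟨v⁻¹, by positivity, fun u => ?_⟩
  calc _ ≤ ∫⁻ y in Metric.ball x r, ENNReal.ofReal v⁻¹ * ENNReal.ofReal (V y * u y ^ 2) := by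
        refine setLIntegral_mono' measurableSet_ball fun y hy => ?_
        rw [← ENNReal.ofReal_mul (by positivity)]
        apply ENNReal.ofReal_le_ofReal
        rw [inv_mul_eq_div, le_div_iff₀ hv, mul_comm]
        exact mul_le_mul_of_nonneg_right (hle y (Metric.ball_subset_closedBall hy)) (sq_nonneg _)
    _ = ENNReal.ofReal v⁻¹ * ∫⁻ y in Metric.ball x r, ENNReal.ofReal (V y * u y ^ 2) :=
        lintegral_const_mul' _ _ ENNReal.ofReal_ne_top
    _ ≤ _ := by
        gcongr
        exact (setLIntegral_le_lintegral _ _).trans (lintegral_weight_le_normSq u)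

theorem memX.integrableOn_ball (hV : Continuous V) (hV0 : ∀ x, 0 < V x) {u : EN N → ℝ}
    (hu : memX α V u) (x : EN N) (r : ℝ) : IntegrableOn u (Metric.ball x r) := by
  obtain ⟨C, -, hC⟩ := exists_setLIntegral_ball_sq_le (α := α) hV hV0 x r
  have hsq : IntegrableOn (fun y => u y ^ 2) (Metric.ball x r) := by
    refine (lintegral_ofReal_ne_top_iff_integrable (hu.1.pow_const 2).aestronglyMeasurable
      (ae_of_all _ fun y => sq_nonneg _)).1 ?_
    exact ((hC u).trans_lt (ENNReal.mul_lt_top ENNReal.ofReal_lt_top hu.2)).ne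
  refine Integrable.mono' ((integrableOn_const (C := (1 : ℝ)) measure_ball_lt_top.ne).add hsq)
    hu.1.aestronglyMeasurable (ae_of_all _ fun y => ?_)
  simp only [Pi.add_apply, Real.norm_eq_abs]
  rw [← sq_abs]
  nlinarith [sq_nonneg (|u y| - 1), abs_nonneg (u y)]

/-- A function of `X` whose subtracted constant is nonzero forces `K` to be integrable. -/
theorem lintegral_weight_lt_top (h1 : H1 V K) (h3 : H3 V K) {u : EN N → ℝ} (hu : memX α V u)
    {c p : ℝ} (hp : 0 < p) (hc : c ≠ 0)
    (hW : ∫⁻ x, ENNReal.ofReal (|u x - c| ^ p) ≠ ⊤) : ∫⁻ x, ENNReal.ofReal (K x) < ⊤ := by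
  obtain ⟨hV0, hK0, B, hB⟩ := h1
  obtain ⟨C₃, hC₃⟩ := h3
  have hm : Measurable fun x => ENNReal.ofReal (|u x - c| ^ p) := by
    have := hu.1
    fun_prop
  have hc2 : 0 < |c| / 2 := by positivity
  set e := ENNReal.ofReal ((|c| / 2) ^ p)
  have he0 : e ≠ 0 := (ENNReal.ofReal_pos.2 (by positivity)).ne'
  set S : Set (EN N) := {x | e ≤ ENNReal.ofReal (|u x - c| ^ p)}
  have hS : MeasurableSet S := measurableSet_le measurable_const hm
  have hSvol : volume S < ⊤ :=
    (meas_ge_le_lintegral_div hm.aemeasurable he0 ENNReal.ofReal_ne_top).trans_lt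
      (ENNReal.div_lt_top hW he0)
  rw [← lintegral_add_compl _ hS, ENNReal.add_lt_top]
  constructor
  · calc _ ≤ ∫⁻ _ in S, ENNReal.ofReal B :=
          lintegral_mono fun x => ENNReal.ofReal_le_ofReal (hB x)
      _ < ⊤ := by
          rw [setLIntegral_const]
          exact ENNReal.mul_lt_top ENNReal.ofReal_lt_top hSvol
  · have hC₃0 : 0 ≤ C₃ := (div_pos (hK0 0) (hV0 0)).le.trans (hC₃ 0)
    calc _ ≤ ∫⁻ x in Sᶜ, ENNReal.ofReal (C₃ / (|c| / 2) ^ 2) * ENNReal.ofReal (V x * u x ^ 2) := by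
          refine setLIntegral_mono' hS.compl fun x hx => ?_
          rw [← ENNReal.ofReal_mul (by positivity)]
          apply ENNReal.ofReal_le_ofReal
          have hx1 : |u x - c| ^ p < (|c| / 2) ^ p :=
            ((ENNReal.ofReal_lt_ofReal_iff (by positivity)).1 (not_le.1 hx))
          have hx2 : |u x - c| < |c| / 2 :=
            (Real.rpow_lt_rpow_iff (abs_nonneg _) hc2.le hp).1 hx1
          have hx3 : |c| / 2 ≤ |u x| := by
            have := abs_sub_abs_le_abs_sub c (u x)
            rw [abs_sub_comm] at this
            linarith
          have hx4 : (|c| / 2) ^ 2 ≤ u x ^ 2 := by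
            rw [← sq_abs (u x)]; gcongr
          have hx5 : K x ≤ C₃ * V x := (div_le_iff₀ (hV0 x)).1 (hC₃ x)
          rw [div_mul_eq_mul_div, le_div_iff₀ (by positivity), ← mul_assoc]
          exact mul_le_mul hx5 hx4 (by positivity) (mul_nonneg hC₃0 (hV0 x).le)
      _ ≤ ∫⁻ x, ENNReal.ofReal (C₃ / (|c| / 2) ^ 2) * ENNReal.ofReal (V x * u x ^ 2) :=
          setLIntegral_le_lintegral _ _
      _ < ⊤ := by
          rw [lintegral_const_mul' _ _ ENNReal.ofReal_ne_top]
          exact ENNReal.mul_lt_top ENNReal.ofReal_lt_top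
            ((lintegral_weight_le_normSq u).trans_lt hu.2)

theorem lintegral_weight_mul_sq_le (h1 : H1 V K) (h3 : H3 V K) :
    ∃ C : ℝ, 0 ≤ C ∧ ∀ u : EN N → ℝ, memX α V u →
      ∫⁻ x, ENNReal.ofReal (K x * u x ^ 2) ≤ ENNReal.ofReal (C * (normSq α V u).toReal) := by
  obtain ⟨hV0, hK0, -⟩ := h1
  obtain ⟨C₃, hC₃⟩ := h3
  have hC₃0 : 0 ≤ C₃ := (div_pos (hK0 0) (hV0 0)).le.trans (hC₃ 0)
  refine ⟨C₃, hC₃0, fun u hu => ?_⟩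
  rw [ENNReal.ofReal_mul hC₃0, ENNReal.ofReal_toReal hu.2.ne]
  calc _ ≤ ∫⁻ x, ENNReal.ofReal C₃ * ENNReal.ofReal (V x * u x ^ 2) := by
        refine lintegral_mono fun x => ?_
        rw [← ENNReal.ofReal_mul hC₃0, ← mul_assoc]
        apply ENNReal.ofReal_le_ofReal
        exact mul_le_mul_of_nonneg_right ((div_le_iff₀ (hV0 x)).1 (hC₃ x)) (sq_nonneg _)
    _ = ENNReal.ofReal C₃ * ∫⁻ x, ENNReal.ofReal (V x * u x ^ 2) :=
        lintegral_const_mul' _ _ ENNReal.ofReal_ne_top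
    _ ≤ _ := by
        gcongr
        exact lintegral_weight_le_normSq u

/-- The weighted critical embedding of `X`. -/
theorem lintegral_weight_mul_abs_rpow_le (hα : 0 < α) (hN : 2 * α < N) (hV : Continuous V)
    (h1 : H1 V K) (h3 : H3 V K) :
    ∃ C : ℝ, 0 ≤ C ∧ ∀ u : EN N → ℝ, memX α V u →
      ∫⁻ x, ENNReal.ofReal (K x * |u x| ^ critExp N α)
        ≤ ENNReal.ofReal (C * (normSq α V u).toReal ^ (critExp N α / 2)) := by
  obtain ⟨Cs, hCs0, hCs⟩ := exists_lintegral_abs_sub_const_rpow_le hα hN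
  obtain ⟨Cb, hCb0, hCb⟩ := exists_setLIntegral_ball_sq_le (α := α) hV h1.1 0 1
  have hω := volume_unitBall_pos N
  set ω := (volume (Metric.ball (0 : EN N) 1)).toReal with hωdef
  obtain ⟨B, hB⟩ := h1.2.2
  have hK0 := h1.2.1
  have hB0 : 0 ≤ B := (hK0 0).le.trans (hB 0)
  have hp2 : 2 < critExp N α := two_lt_critExp hα hN
  set p := critExp N α with hp
  set κ := (∫⁻ x, ENNReal.ofReal (K x)).toReal
  set C₁ : ℝ := Cs + √(Cb / ω)
  have hC₁ : 0 ≤ C₁ := by positivity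
  refine ⟨2 ^ (p - 1) * (B * Cs + C₁ ^ p * κ), by positivity, fun u hu => ?_⟩
  have hG : gagSq N α u ≠ ⊤ := ((gagSq_le_normSq u).trans_lt hu.2).ne
  have huI := hu.integrableOn_ball hV h1.1
  obtain ⟨c, hc1, hc2⟩ := hCs u hu.1 huI hG
  set G := (gagSq N α u).toReal
  set n := (normSq α V u).toReal with hn
  have hn0 : 0 ≤ n := ENNReal.toReal_nonneg
  have hGn : G ≤ n := ENNReal.toReal_mono hu.2.ne (gagSq_le_normSq u)
  have hG0 : 0 ≤ G := ENNReal.toReal_nonneg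
  have hcn : |c| ≤ C₁ * √n := by
    have h := (sq_setAverage_sub_mul_le (Metric.measure_ball_pos volume (0 : EN N) one_pos).ne'
      measure_ball_lt_top.ne (huI 0 1) 0).trans (by simpa using hCb u)
    set m := ⨍ z in Metric.ball 0 1, u z
    rw [← ENNReal.ofReal_toReal measure_ball_lt_top.ne, ← ENNReal.ofReal_toReal hu.2.ne,
      ← ENNReal.ofReal_mul (by positivity), ← ENNReal.ofReal_mul (by positivity),
      ENNReal.ofReal_le_ofReal_iff (by positivity), ← hωdef, ← hn, sub_zero] at h
    have hm : |m| ≤ √(Cb / ω) * √n := by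
      rw [← Real.sqrt_mul (by positivity)]
      apply Real.abs_le_sqrt
      rw [div_mul_eq_mul_div, le_div_iff₀ hω]
      exact h
    have h4 : Cs * √G ≤ Cs * √n := by gcongr
    have h5 := abs_sub_abs_le_abs_sub c m
    rw [abs_sub_comm] at h5
    have : C₁ * √n = Cs * √n + √(Cb / ω) * √n := by ring
    linarith
  have hcp : |c| ^ p ≤ C₁ ^ p * n ^ (p / 2) := by
    calc |c| ^ p ≤ (C₁ * √n) ^ p := by gcongr
      _ = _ := by
        rw [Real.mul_rpow hC₁ (by positivity), Real.sqrt_eq_rpow, ← Real.rpow_mul hn0]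
        congr 2; ring
  have hc2' : ∫⁻ x, ENNReal.ofReal (|u x - c| ^ p) ≤ ENNReal.ofReal (Cs * n ^ (p / 2)) :=
    hc2.trans (ENNReal.ofReal_le_ofReal (by gcongr))
  have hKc : ENNReal.ofReal (|c| ^ p) * ∫⁻ x, ENNReal.ofReal (K x)
      ≤ ENNReal.ofReal (C₁ ^ p * n ^ (p / 2) * κ) := by
    rcases eq_or_ne c 0 with rfl | hc0
    · rw [abs_zero, Real.zero_rpow (by linarith)]
      simp
    · have hfin := lintegral_weight_lt_top h1 h3 hu (p := p) (by linarith) hc0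
        (hc2'.trans_lt ENNReal.ofReal_lt_top).ne
      rw [ENNReal.ofReal_mul (by positivity), ENNReal.ofReal_toReal hfin.ne]
      gcongr
  have hKm : Measurable fun x => ENNReal.ofReal (B * |u x - c| ^ p) := by
    have := hu.1
    fun_prop
  calc _ ≤ ∫⁻ x, ENNReal.ofReal (2 ^ (p - 1)) * (ENNReal.ofReal (B * |u x - c| ^ p)
        + ENNReal.ofReal (|c| ^ p) * ENNReal.ofReal (K x)) := by
        refine lintegral_mono fun x => ?_
        have hKx := (hK0 x).le
        rw [← ENNReal.ofReal_mul (by positivity), ← ENNReal.ofReal_add (by positivity)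
          (by positivity), ← ENNReal.ofReal_mul (by positivity)]
        apply ENNReal.ofReal_le_ofReal
        have h1 : |u x| ^ p ≤ 2 ^ (p - 1) * (|u x - c| ^ p + |c| ^ p) := by
          have h := NNReal.rpow_add_le_mul_rpow_add_rpow (Real.nnabs (u x - c)) (Real.nnabs c)
            (p := p) (by linarith)
          rw [← NNReal.coe_le_coe] at h
          push_cast [Real.coe_nnabs] at h
          refine le_trans ?_ h
          gcongr
          simpa using abs_add_le (u x - c) c
        calc K x * |u x| ^ p ≤ K x * (2 ^ (p - 1) * (|u x - c| ^ p + |c| ^ p)) := by gcongr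
          _ = 2 ^ (p - 1) * (K x * |u x - c| ^ p + |c| ^ p * K x) := by ring
          _ ≤ _ := by gcongr; exact hB x
    _ = ENNReal.ofReal (2 ^ (p - 1)) * (ENNReal.ofReal B * (∫⁻ x, ENNReal.ofReal (|u x - c| ^ p))
        + ENNReal.ofReal (|c| ^ p) * ∫⁻ x, ENNReal.ofReal (K x)) := by
        rw [lintegral_const_mul' _ _ ENNReal.ofReal_ne_top, lintegral_add_left hKm,
          lintegral_const_mul' _ _ ENNReal.ofReal_ne_top]
        simp_rw [ENNReal.ofReal_mul hB0]
        rw [lintegral_const_mul' _ _ ENNReal.ofReal_ne_top]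
    _ ≤ ENNReal.ofReal (2 ^ (p - 1)) * (ENNReal.ofReal B * ENNReal.ofReal (Cs * n ^ (p / 2))
        + ENNReal.ofReal (C₁ ^ p * n ^ (p / 2) * κ)) := by gcongr
    _ = _ := by
        rw [← ENNReal.ofReal_mul hB0, ← ENNReal.ofReal_add (by positivity) (by positivity),
          ← ENNReal.ofReal_mul (by positivity)]
        congr 1; ring

end Weights

section Nonlinearity

variable {f : ℝ → ℝ}

theorem prim_reflect (f : ℝ → ℝ) (t : ℝ) : prim (fun s => -f (-s)) t = prim f (-t) := by
  unfold prim
  rw [intervalIntegral.integral_neg, intervalIntegral.integral_comp_neg, neg_zero,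
    intervalIntegral.integral_symm, neg_neg]

theorem Cf1.reflect (hf1 : Cf1 f) : Cf1 fun s => -f (-s) := by
  have hn : Tendsto (fun t : ℝ => -t) (nhdsWithin 0 {(0 : ℝ)}ᶜ) (nhdsWithin 0 {(0 : ℝ)}ᶜ) := by
    refine tendsto_nhdsWithin_iff.2 ⟨?_, ?_⟩
    · have := (continuous_neg (G := ℝ)).tendsto 0
      rw [neg_zero] at this
      exact this.mono_left nhdsWithin_le_nhds
    · filter_upwards [self_mem_nhdsWithin] with t ht
      simpa using ht
  have h := (hf1.comp hn).neg
  rw [neg_zero] at h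
  refine h.congr fun t => ?_
  simp only [Function.comp_apply, abs_neg]
  ring

theorem Cf4.reflect (hf4 : Cf4 f) : Cf4 fun s => -f (-s) := by
  intro s t hs ht hst
  have h := hf4 (-t) (-s) (neg_ne_zero.2 ht) (neg_ne_zero.2 hs) (neg_lt_neg hst)
  rw [abs_neg, abs_neg] at h
  rw [neg_div, neg_div]
  linarith

theorem pos_of_pos (hf1 : Cf1 f) (hf4 : Cf4 f) {t : ℝ} (ht : 0 < t) : 0 < f t := by
  have h1 : Tendsto (fun t : ℝ => f t / |t|) (nhdsWithin 0 (Set.Ioi 0)) (nhds 0) :=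
    hf1.mono_left (nhdsWithin_mono _ fun x hx => ne_of_gt hx)
  have h2 : 0 ≤ f (t / 2) / |t / 2| := by
    refine le_of_tendsto h1 ?_
    filter_upwards [Ioo_mem_nhdsGT (half_pos ht)] with s hs
    exact (hf4 s (t / 2) hs.1.ne' (half_pos ht).ne' hs.2).le
  have h3 := h2.trans_lt (hf4 (t / 2) t (half_pos ht).ne' ht.ne' (half_lt_self ht))
  rw [abs_of_pos ht] at h3
  exact (div_pos_iff_of_pos_right ht).1 h3

theorem mul_self_nonneg_of_cf (hf1 : Cf1 f) (hf4 : Cf4 f) (t : ℝ) : 0 ≤ f t * t := by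
  rcases lt_trichotomy t 0 with ht | rfl | ht
  · have := pos_of_pos hf1.reflect hf4.reflect (neg_pos.2 ht)
    simp only [neg_neg] at this
    nlinarith
  · simp
  · exact (mul_pos (pos_of_pos hf1 hf4 ht) ht).le

theorem prim_nonneg_of_nonneg (hf : Continuous f) (hf1 : Cf1 f) (hf4 : Cf4 f) {t : ℝ}
    (ht : 0 ≤ t) : 0 ≤ prim f t := by
  have h := intervalIntegral.integral_mono_on_of_le_Ioo (f := fun _ => (0 : ℝ)) (g := f)
    (μ := volume) ht (by simp) (hf.intervalIntegrable 0 t)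
    fun x hx => (pos_of_pos hf1 hf4 hx.1).le
  simpa [prim] using h

theorem prim_nonneg (hf : Continuous f) (hf1 : Cf1 f) (hf4 : Cf4 f) (t : ℝ) : 0 ≤ prim f t := by
  rcases le_total 0 t with ht | ht
  · exact prim_nonneg_of_nonneg hf hf1 hf4 ht
  · have := prim_nonneg_of_nonneg (f := fun s => -f (-s)) (by fun_prop) hf1.reflect hf4.reflect
      (neg_nonneg.2 ht)
    rwa [prim_reflect, neg_neg] at this

theorem fiber_le_of_pos (hf : Continuous f) (hf4 : Cf4 f) {s t : ℝ} (hs : 0 < s) (ht : 0 ≤ t) :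
    (t ^ 2 - 1) / 2 * (f s * s) ≤ prim f (t * s) - prim f s := by
  have hI : ∀ a b, IntervalIntegrable f volume a b := fun a b => hf.intervalIntegrable a b
  have hL : ∀ a b, IntervalIntegrable (fun τ => f s / s * τ) volume a b :=
    fun a b => (by fun_prop : Continuous fun τ => f s / s * τ).intervalIntegrable a b
  have hint : ∀ a b : ℝ, ∫ τ in a..b, f s / s * τ = f s / s * ((b ^ 2 - a ^ 2) / 2) := by
    intro a b
    rw [intervalIntegral.integral_const_mul, integral_id]
  have hb : 0 ≤ t * s := by positivity
  have e1 : prim f (t * s) - prim f s = ∫ τ in s..(t * s), f τ :=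
    intervalIntegral.integral_interval_sub_left (hI _ _) (hI _ _)
  have e2 : (t ^ 2 - 1) / 2 * (f s * s) = ∫ τ in s..(t * s), f s / s * τ := by
    rw [hint]; field_simp
  rw [e1, e2]
  rcases le_total s (t * s) with h | h
  · refine intervalIntegral.integral_mono_on_of_le_Ioo h (hL _ _) (hI _ _) fun τ hτ => ?_
    have h0 : 0 < τ := hs.trans hτ.1
    have := hf4 s τ hs.ne' h0.ne' hτ.1
    rw [abs_of_pos hs, abs_of_pos h0, lt_div_iff₀ h0] at this
    exact this.le
  · rw [intervalIntegral.integral_symm, intervalIntegral.integral_symm (t * s) s]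
    refine neg_le_neg ?_
    refine intervalIntegral.integral_mono_on_of_le_Ioo h (hI _ _) (hL _ _) fun τ hτ => ?_
    have h0 : 0 < τ := hb.trans_lt hτ.1
    have := hf4 τ s h0.ne' hs.ne' hτ.2
    rw [abs_of_pos hs, abs_of_pos h0, div_lt_iff₀ h0] at this
    exact this.le

/-- The pointwise inequality behind the maximality of `J` on fibres through Nehari points. -/
theorem fiber_le (hf : Continuous f) (hf4 : Cf4 f) (s : ℝ) {t : ℝ} (ht : 0 ≤ t) :
    (t ^ 2 - 1) / 2 * (f s * s) ≤ prim f (t * s) - prim f s := by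
  rcases lt_trichotomy s 0 with hs | rfl | hs
  · have := fiber_le_of_pos (f := fun s => -f (-s)) (by fun_prop) hf4.reflect (neg_pos.2 hs) ht
    simp only [prim_reflect, neg_neg, mul_neg, neg_mul] at this
    linarith
  · simp
  · exact fiber_le_of_pos hf hf4 hs ht

theorem two_mul_prim_le (hf : Continuous f) (hf4 : Cf4 f) (s : ℝ) : 2 * prim f s ≤ f s * s := by
  have := fiber_le hf hf4 s le_rfl
  have h0 : prim f (0 * s) = 0 := by simp [prim]
  rw [h0] at this
  linarith

theorem exists_growth (hf : Continuous f) (hf1 : Cf1 f) {p : ℝ} (hp : 0 < p) (hf2 : Cf2 f p)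
    {ε : ℝ} (hε : 0 < ε) : ∃ C : ℝ, 0 ≤ C ∧ ∀ t : ℝ, f t * t ≤ ε * t ^ 2 + C * |t| ^ p := by
  have h1 := hf1.eventually (Metric.ball_mem_nhds 0 hε)
  rw [eventually_nhdsWithin_iff, Metric.eventually_nhds_iff] at h1
  obtain ⟨δ, hδ, h1⟩ := h1
  have h2 := hf2.eventually (Metric.ball_mem_nhds 0 one_pos)
  rw [eventually_comap] at h2
  obtain ⟨M, h2⟩ := eventually_atTop.1 h2
  obtain ⟨B, hB⟩ := (isCompact_Icc (a := -M) (b := M)).exists_bound_of_continuousOn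
    (f := fun t => f t * t) (by fun_prop)
  refine ⟨1 + |B| / δ ^ p, by positivity, fun t => ?_⟩
  have hnn : 0 ≤ |B| / δ ^ p := by positivity
  have hTp : 0 ≤ |t| ^ p := by positivity
  have habs : f t * t ≤ |f t| * |t| := by rw [← abs_mul]; exact le_abs_self _
  rcases eq_or_ne t 0 with rfl | ht0
  · rw [mul_zero]; positivity
  have hat : 0 < |t| := abs_pos.2 ht0
  by_cases hs : |t| < δ
  · have h := h1 (y := t) (by simpa using hs) ht0
    simp only [dist_zero_right, Real.norm_eq_abs, abs_div, abs_abs] at h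
    rw [div_lt_iff₀ hat] at h
    have : |f t| * |t| ≤ ε * t ^ 2 := by rw [← sq_abs]; nlinarith
    nlinarith [mul_nonneg hnn hTp]
  · push Not at hs
    by_cases hl : M ≤ |t|
    · have h := h2 |t| hl t rfl
      have hq : 0 < |t| ^ (p - 1) := by positivity
      simp only [dist_zero_right, Real.norm_eq_abs, abs_div,
        abs_of_pos hq] at h
      rw [div_lt_iff₀ hq, one_mul] at h
      have e : |t| ^ (p - 1) * |t| = |t| ^ p := by
        rw [Real.rpow_sub_one hat.ne']; field_simp
      nlinarith [mul_nonneg hnn hTp, sq_nonneg t]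
    · push Not at hl
      have h := hB t (abs_le.1 hl.le)
      have h3 : δ ^ p ≤ |t| ^ p := by gcongr
      have h4 : |B| ≤ |B| / δ ^ p * |t| ^ p := by
        rw [div_mul_eq_mul_div, le_div_iff₀ (by positivity)]
        gcongr
      have h5 : f t * t ≤ |B| := (le_abs_self _).trans (h.trans (le_abs_self _))
      nlinarith [sq_nonneg t]

theorem tendsto_mul_div_sq_atTop (hf : Continuous f) (hf3 : Cf3 f) (hf4 : Cf4 f) {s : ℝ}
    (hs : s ≠ 0) :
    Tendsto (fun n : ℕ => f (n * s) * (n * s) / (n : ℝ) ^ 2) atTop atTop := by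
  have h1 : Tendsto (fun n : ℕ => (n : ℝ) * s) atTop (comap (fun t : ℝ => |t|) atTop) := by
    rw [tendsto_comap_iff]
    have : ((fun t : ℝ => |t|) ∘ fun n : ℕ => (n : ℝ) * s) = fun n : ℕ => (n : ℝ) * |s| := by
      ext n; simp [abs_mul]
    rw [this]
    exact tendsto_natCast_atTop_atTop.atTop_mul_const (abs_pos.2 hs)
  have h2 := (hf3.comp h1).atTop_mul_const (show 0 < 2 * s ^ 2 by positivity)
  refine tendsto_atTop_mono' _ ?_ h2
  filter_upwards [eventually_gt_atTop 0] with n hn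
  have hn' : (0 : ℝ) < n := by exact_mod_cast hn
  have e : prim f (n * s) / (n * s) ^ 2 * (2 * s ^ 2) = 2 * prim f (n * s) / (n : ℝ) ^ 2 := by
    field_simp
  simp only [Function.comp_apply]
  rw [e]
  exact div_le_div_of_nonneg_right (two_mul_prim_le hf hf4 _) (by positivity)

end Nonlinearity

section Nehari

variable {N : ℕ} {α : ℝ} {V K : EN N → ℝ} {f : ℝ → ℝ}

theorem normSq_const_mul (t : ℝ) (u : EN N → ℝ) :
    normSq α V (fun x => t * u x) = ENNReal.ofReal (t ^ 2) * normSq α V u := by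
  unfold normSq gagSq
  rw [mul_add, ← lintegral_const_mul' _ _ ENNReal.ofReal_ne_top,
    ← lintegral_const_mul' _ _ ENNReal.ofReal_ne_top]
  congr 1 <;> refine lintegral_congr fun x => ?_ <;> rw [← ENNReal.ofReal_mul (sq_nonneg t)] <;>
    congr 1 <;> ring

theorem toReal_normSq_const_mul (t : ℝ) (u : EN N → ℝ) :
    (normSq α V fun x => t * u x).toReal = t ^ 2 * (normSq α V u).toReal := by
  rw [normSq_const_mul, ENNReal.toReal_mul, ENNReal.toReal_ofReal (sq_nonneg t)]

theorem memX.const_mul {u : EN N → ℝ} (hu : memX α V u) (t : ℝ) : memX α V fun x => t * u x :=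
  ⟨hu.1.const_mul t, by
    rw [normSq_const_mul]
    exact ENNReal.mul_lt_top ENNReal.ofReal_lt_top hu.2⟩

theorem NotAEZero.const_mul {u : EN N → ℝ} (hu : NotAEZero u) {t : ℝ} (ht : t ≠ 0) :
    NotAEZero fun x => t * u x := fun h => hu <| by
  filter_upwards [h] with x hx
  exact (mul_eq_zero.1 hx).resolve_left ht

theorem toReal_normSq_pos (hV : Continuous V) (hV0 : ∀ x, 0 < V x) {u : EN N → ℝ}
    (hu : memX α V u) (h0 : NotAEZero u) : 0 < (normSq α V u).toReal := by
  refine ENNReal.toReal_pos (fun h => h0 ?_) hu.2.ne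
  have h1 : ∫⁻ x, ENNReal.ofReal (V x * u x ^ 2) = 0 :=
    le_antisymm ((lintegral_weight_le_normSq u).trans h.le) zero_le
  have hm := hu.1
  have hVm := hV.measurable
  rw [lintegral_eq_zero_iff (by fun_prop)] at h1
  filter_upwards [h1] with x hx
  have hx' : V x * u x ^ 2 ≤ 0 := ENNReal.ofReal_eq_zero.1 hx
  have : u x ^ 2 ≤ 0 := by
    by_contra! hlt
    exact absurd (mul_pos (hV0 x) hlt) (not_lt.2 hx')
  simpa using pow_eq_zero_iff (two_ne_zero) |>.1 (le_antisymm this (sq_nonneg _))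

theorem integrable_and_integral_le {g : EN N → ℝ} (hg : Measurable g) (hg0 : ∀ x, 0 ≤ g x)
    {c : ℝ} (hc : 0 ≤ c) (h : ∫⁻ x, ENNReal.ofReal (g x) ≤ ENNReal.ofReal c) :
    Integrable g ∧ ∫ x, g x ≤ c := by
  have hi : Integrable g := (lintegral_ofReal_ne_top_iff_integrable hg.aestronglyMeasurable
    (ae_of_all _ hg0)).1 (h.trans_lt ENNReal.ofReal_lt_top).ne
  refine ⟨hi, ?_⟩
  rwa [← ofReal_integral_eq_lintegral_ofReal hi (ae_of_all _ hg0),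
    ENNReal.ofReal_le_ofReal_iff hc] at h

/-- Data of the weighted embeddings of `X` into `L²_K` and `L^p_K`. -/
theorem exists_weighted_embeddings (hα : 0 < α) (hN : 2 * α < N) (hV : Continuous V)
    (hK : Continuous K) (h1 : H1 V K) (h3 : H3 V K) :
    ∃ C : ℝ, 0 < C ∧ ∀ u : EN N → ℝ, memX α V u →
      (Integrable (fun x => K x * u x ^ 2) ∧
        ∫ x, K x * u x ^ 2 ≤ C * (normSq α V u).toReal) ∧
      (Integrable (fun x => K x * |u x| ^ critExp N α) ∧
        ∫ x, K x * |u x| ^ critExp N α ≤ C * (normSq α V u).toReal ^ (critExp N α / 2)) := by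
  obtain ⟨A, hA0, hA⟩ := lintegral_weight_mul_sq_le (α := α) h1 h3
  obtain ⟨B, hB0, hB⟩ := lintegral_weight_mul_abs_rpow_le hα hN hV h1 h3
  have hK0 := h1.2.1
  have hKm := hK.measurable
  refine ⟨A + B + 1, by positivity, fun u hu => ⟨?_, ?_⟩⟩
  · have hm := hu.1
    have h := integrable_and_integral_le (by fun_prop)
      (fun x => mul_nonneg (hK0 x).le (sq_nonneg (u x))) (by positivity) (hA u hu)
    exact ⟨h.1, h.2.trans (mul_le_mul_of_nonneg_right (by linarith) ENNReal.toReal_nonneg)⟩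
  · have hm := hu.1
    have h := integrable_and_integral_le (by fun_prop)
      (fun x => mul_nonneg (hK0 x).le (by positivity)) (by positivity) (hB u hu)
    exact ⟨h.1, h.2.trans (mul_le_mul_of_nonneg_right (by linarith) (by positivity))⟩

theorem integrable_weight_mul_self
    (hα : 0 < α) (hN : 2 * α < N) (hV : Continuous V) (hK : Continuous K)
    (hf : Continuous f) (h1 : H1 V K) (h3 : H3 V K)
    (hf1 : Cf1 f) (hf2 : Cf2 f (critExp N α)) (hf4 : Cf4 f)
    {u : EN N → ℝ} (hu : memX α V u) :
    Integrable fun x => K x * f (u x) * u x := by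
  obtain ⟨A, -, hA⟩ := exists_weighted_embeddings hα hN hV hK h1 h3
  obtain ⟨⟨hi2, -⟩, hip, -⟩ := hA u hu
  have hp := two_lt_critExp hα hN
  obtain ⟨C, hC0, hC⟩ := exists_growth hf hf1 (by linarith) hf2 one_pos
  have hm := hu.1
  have hKm := hK.measurable
  have hfm := hf.measurable
  refine Integrable.mono' (hi2.add (hip.const_mul C)) (by fun_prop) (ae_of_all _ fun x => ?_)
  have hKx := (h1.2.1 x).le
  rw [Real.norm_eq_abs, mul_assoc, abs_of_nonneg (mul_nonneg hKx
    (mul_self_nonneg_of_cf hf1 hf4 _))]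
  refine (mul_le_mul_of_nonneg_left (hC (u x)) hKx).trans (le_of_eq ?_)
  simp only [Pi.add_apply]
  ring

theorem integrable_weight_mul_prim
    (hα : 0 < α) (hN : 2 * α < N) (hV : Continuous V) (hK : Continuous K)
    (hf : Continuous f) (h1 : H1 V K) (h3 : H3 V K)
    (hf1 : Cf1 f) (hf2 : Cf2 f (critExp N α)) (hf4 : Cf4 f)
    {u : EN N → ℝ} (hu : memX α V u) :
    Integrable fun x => K x * prim f (u x) := by
  have hm := hu.1
  have hKm := hK.measurable
  have hpm : Measurable (prim f) :=
    (intervalIntegral.continuous_primitive (fun a b => hf.intervalIntegrable a b) 0).measurable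
  refine Integrable.mono' (integrable_weight_mul_self hα hN hV hK hf h1 h3 hf1 hf2 hf4 hu)
    (hKm.mul (hpm.comp hm)).aestronglyMeasurable (ae_of_all _ fun x => ?_)
  have hKx := (h1.2.1 x).le
  have h0 := prim_nonneg hf hf1 hf4 (u x)
  rw [Real.norm_eq_abs, mul_assoc, abs_of_nonneg (mul_nonneg hKx h0)]
  exact mul_le_mul_of_nonneg_left (by linarith [two_mul_prim_le hf hf4 (u x)]) hKx

theorem exists_sphere_integral_le
    (hα : 0 < α) (hN : 2 * α < N) (hV : Continuous V) (hK : Continuous K)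
    (hf : Continuous f) (h1 : H1 V K) (h3 : H3 V K)
    (hf1 : Cf1 f) (hf2 : Cf2 f (critExp N α)) (hf4 : Cf4 f) :
    ∃ ρ : ℝ, 0 < ρ ∧ ∀ u : EN N → ℝ, memX α V u → (normSq α V u).toReal = ρ →
      ∫ x, K x * f (u x) * u x ≤ ρ / 2 := by
  obtain ⟨A, hA0, hA⟩ := exists_weighted_embeddings hα hN hV hK h1 h3
  have hp := two_lt_critExp hα hN
  obtain ⟨C, hC0, hC⟩ := exists_growth hf hf1 (by linarith) hf2 (ε := 1 / (4 * A)) (by positivity)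
  set p := critExp N α
  have hlim : Tendsto (fun ρ : ℝ => C * A * ρ ^ (p / 2 - 1)) (nhdsWithin 0 (Set.Ioi 0))
      (nhds 0) := by
    have hc : Continuous fun ρ : ℝ => C * A * ρ ^ (p / 2 - 1) :=
      continuous_const.mul (Real.continuous_rpow_const (by linarith))
    have := (hc.tendsto 0).mono_left (nhdsWithin_le_nhds (s := Set.Ioi 0))
    rwa [Real.zero_rpow (by linarith), mul_zero] at this
  obtain ⟨ρ, hρ, hρ0⟩ := ((hlim.eventually_lt_const (show (0 : ℝ) < 1 / 4 by norm_num)).and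
    self_mem_nhdsWithin).exists
  have hρ0 : 0 < ρ := hρ0
  refine ⟨ρ, hρ0, fun u hu hn => ?_⟩
  obtain ⟨⟨hi2, hb2⟩, hip, hbp⟩ := hA u hu
  rw [hn] at hb2 hbp
  calc ∫ x, K x * f (u x) * u x
      ≤ ∫ x, (1 / (4 * A) * (K x * u x ^ 2) + C * (K x * |u x| ^ p)) := by
        refine integral_mono (integrable_weight_mul_self hα hN hV hK hf h1 h3 hf1 hf2 hf4 hu)
          ((hi2.const_mul _).add (hip.const_mul C)) fun x => ?_
        have := mul_le_mul_of_nonneg_left (hC (u x)) (h1.2.1 x).le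
        simp only
        linarith
    _ = 1 / (4 * A) * (∫ x, K x * u x ^ 2) + C * ∫ x, K x * |u x| ^ p := by
        rw [integral_add (hi2.const_mul _) (hip.const_mul C), integral_const_mul,
          integral_const_mul]
    _ ≤ 1 / (4 * A) * (A * ρ) + C * (A * ρ ^ (p / 2)) := by gcongr
    _ = ρ / 4 + C * A * ρ ^ (p / 2 - 1) * ρ := by
        rw [Real.rpow_sub_one hρ0.ne']; field_simp
    _ ≤ ρ / 4 + 1 / 4 * ρ := by gcongr
    _ = ρ / 2 := by ring

theorem continuousOn_integral_fiber
    (hα : 0 < α) (hN : 2 * α < N) (hV : Continuous V) (hK : Continuous K)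
    (hf : Continuous f) (h1 : H1 V K) (h3 : H3 V K)
    (hf1 : Cf1 f) (hf2 : Cf2 f (critExp N α)) (hf4 : Cf4 f)
    {u : EN N → ℝ} (hu : memX α V u) {a b : ℝ} (ha : 0 ≤ a) :
    ContinuousOn (fun t : ℝ => ∫ x, K x * f (t * u x) * (t * u x)) (Set.Icc a b) := by
  obtain ⟨A, -, hA⟩ := exists_weighted_embeddings hα hN hV hK h1 h3
  obtain ⟨⟨hi2, -⟩, hip, -⟩ := hA _ (hu.const_mul b)
  have hp := two_lt_critExp hα hN
  obtain ⟨C, hC0, hC⟩ := exists_growth hf hf1 (by linarith) hf2 one_pos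
  have hm := hu.1
  have hKm := hK.measurable
  have hfm := hf.measurable
  refine continuousOn_of_dominated (fun t _ => by fun_prop) (fun t ht => ae_of_all _ fun x => ?_)
    (hi2.add (hip.const_mul C)) (ae_of_all _ fun x => by fun_prop)
  have hKx := (h1.2.1 x).le
  have ht0 : 0 ≤ t := ha.trans ht.1
  have habs : |t * u x| ≤ |b * u x| := by
    rw [abs_mul, abs_mul, abs_of_nonneg ht0, abs_of_nonneg (ht0.trans ht.2)]
    exact mul_le_mul_of_nonneg_right ht.2 (abs_nonneg _)
  rw [Real.norm_eq_abs, mul_assoc, abs_of_nonneg (mul_nonneg hKx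
    (mul_self_nonneg_of_cf hf1 hf4 _))]
  have h5 : (t * u x) ^ 2 ≤ (b * u x) ^ 2 := sq_le_sq.2 habs
  have h6 : |t * u x| ^ critExp N α ≤ |b * u x| ^ critExp N α := by gcongr
  have h7 : f (t * u x) * (t * u x) ≤ (b * u x) ^ 2 + C * |b * u x| ^ critExp N α := by
    have := mul_le_mul_of_nonneg_left h6 hC0
    linarith [hC (t * u x)]
  refine (mul_le_mul_of_nonneg_left h7 hKx).trans (le_of_eq ?_)
  simp only [Pi.add_apply]
  ring

theorem exists_large_fiber
    (hα : 0 < α) (hN : 2 * α < N) (hV : Continuous V) (hK : Continuous K)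
    (hf : Continuous f) (h1 : H1 V K) (h3 : H3 V K)
    (hf1 : Cf1 f) (hf2 : Cf2 f (critExp N α)) (hf3 : Cf3 f) (hf4 : Cf4 f)
    {u : EN N → ℝ} (hu : memX α V u) (h0 : NotAEZero u) (t₀ : ℝ) :
    ∃ b : ℝ, t₀ ≤ b ∧ b ^ 2 * (normSq α V u).toReal ≤ ∫ x, K x * f (b * u x) * (b * u x) := by
  by_contra! hcon
  set n := (normSq α V u).toReal
  have hm := hu.1
  have hKm := hK.measurable
  have hfm := hf.measurable
  let g : ℕ → EN N → ENNReal := fun m x =>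
    ENNReal.ofReal (K x * (f (m * u x) * (m * u x) / (m : ℝ) ^ 2))
  have hg : ∀ m : ℕ, t₀ ≤ m → 0 < m → ∫⁻ x, g m x ≤ ENNReal.ofReal n := by
    intro m hm0 hmpos
    have hmp : (0 : ℝ) < m := by exact_mod_cast hmpos
    have h := hcon m hm0
    have hi := (integrable_weight_mul_self hα hN hV hK hf h1 h3 hf1 hf2 hf4
      (hu.const_mul (m : ℝ))).div_const ((m : ℝ) ^ 2)
    have hnn : ∀ x, 0 ≤ K x * f (m * u x) * (m * u x) / (m : ℝ) ^ 2 := fun x => by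
      rw [mul_assoc]
      exact div_nonneg (mul_nonneg (h1.2.1 x).le (mul_self_nonneg_of_cf hf1 hf4 _)) (sq_nonneg _)
    have e : ∫⁻ x, g m x = ∫⁻ x, ENNReal.ofReal (K x * f (m * u x) * (m * u x) / (m : ℝ) ^ 2) := by
      refine lintegral_congr fun x => ?_
      simp only [g]
      congr 1; ring
    rw [e, ← ofReal_integral_eq_lintegral_ofReal hi (ae_of_all _ hnn), integral_div]
    apply ENNReal.ofReal_le_ofReal
    rw [div_le_iff₀ (by positivity)]
    linarith
  have hF := lintegral_liminf_le (μ := (volume : Measure (EN N))) (f := g) (u := atTop)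
    fun m => by fun_prop
  have hev : ∀ᶠ m : ℕ in atTop, ∫⁻ x, g m x ≤ ENNReal.ofReal n := by
    filter_upwards [eventually_ge_atTop ⌈t₀⌉₊, eventually_gt_atTop 0] with m hm1 hm2
    exact hg m ((Nat.le_ceil _).trans (by exact_mod_cast hm1)) hm2
  have hle : liminf (fun m => ∫⁻ x, g m x) atTop ≤ ENNReal.ofReal n :=
    liminf_le_of_frequently_le' hev.frequently
  have hlt : ∀ᵐ x, liminf (fun m => g m x) atTop < ⊤ :=
    ae_lt_top (Measurable.liminf fun m => by fun_prop)
      ((hF.trans hle).trans_lt ENNReal.ofReal_lt_top).ne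
  refine h0 ?_
  filter_upwards [hlt] with x hx
  by_contra hux
  have ht : Tendsto (fun m => g m x) atTop (nhds ⊤) :=
    ENNReal.tendsto_ofReal_nhds_top.2
      ((tendsto_mul_div_sq_atTop hf hf3 hf4 hux).const_mul_atTop (h1.2.1 x))
  rw [ht.liminf_eq] at hx
  exact hx.ne rfl

/-- Every nonzero ray meets the Nehari manifold. -/
theorem exists_memNehari2_const_mul
    (hα : 0 < α) (hN : 2 * α < N) (hV : Continuous V) (hK : Continuous K)
    (hf : Continuous f) (h1 : H1 V K) (h3 : H3 V K)
    (hf1 : Cf1 f) (hf2 : Cf2 f (critExp N α)) (hf3 : Cf3 f) (hf4 : Cf4 f)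
    {u : EN N → ℝ} (hu : memX α V u) (h0 : NotAEZero u) :
    ∃ t : ℝ, 0 < t ∧ memNehari2 α V K f fun x => t * u x := by
  obtain ⟨ρ, hρ0, hρ⟩ := exists_sphere_integral_le hα hN hV hK hf h1 h3 hf1 hf2 hf4
  have hn := toReal_normSq_pos hV h1.1 hu h0
  set n := (normSq α V u).toReal with hndef
  set t₀ := √(ρ / n)
  have ht₀ : 0 < t₀ := by positivity
  have ht₀n : t₀ ^ 2 * n = ρ := by
    rw [Real.sq_sqrt (by positivity)]; field_simp
  obtain ⟨b, hb0, hb⟩ := exists_large_fiber hα hN hV hK hf h1 h3 hf1 hf2 hf3 hf4 hu h0 t₀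
  have hlow := hρ _ (hu.const_mul t₀) (by rw [toReal_normSq_const_mul, ht₀n])
  have hcont : ContinuousOn
      (fun t : ℝ => (∫ x, K x * f (t * u x) * (t * u x)) - t ^ 2 * n) (Set.Icc t₀ b) :=
    (continuousOn_integral_fiber hα hN hV hK hf h1 h3 hf1 hf2 hf4 hu ht₀.le).sub (by fun_prop)
  obtain ⟨t, ht, hz⟩ := intermediate_value_Icc hb0 hcont
    (show (0 : ℝ) ∈ Set.Icc _ _ from ⟨by linarith, by linarith⟩)
  have htpos : 0 < t := ht₀.trans_le ht.1
  refine ⟨t, htpos, hu.const_mul t, h0.const_mul htpos.ne', ?_⟩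
  rw [toReal_normSq_const_mul, ← hndef]
  simp only at hz
  linarith

/-- A Nehari point maximizes `J` on its ray. -/
theorem Jfun_const_mul_le_of_memNehari2
    (hα : 0 < α) (hN : 2 * α < N) (hV : Continuous V) (hK : Continuous K)
    (hf : Continuous f) (h1 : H1 V K) (h3 : H3 V K)
    (hf1 : Cf1 f) (hf2 : Cf2 f (critExp N α)) (hf4 : Cf4 f)
    {u : EN N → ℝ} (hu : memNehari2 α V K f u) {t : ℝ}
    (ht : 0 ≤ t) : Jfun α V K f (fun x => t * u x) ≤ Jfun α V K f u := by
  obtain ⟨hX, -, he⟩ := hu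
  have hi1 := integrable_weight_mul_self hα hN hV hK hf h1 h3 hf1 hf2 hf4 hX
  have hi2 := integrable_weight_mul_prim hα hN hV hK hf h1 h3 hf1 hf2 hf4 hX
  have hi3 := integrable_weight_mul_prim hα hN hV hK hf h1 h3 hf1 hf2 hf4 (hX.const_mul t)
  have h : ∫ x, (t ^ 2 - 1) / 2 * (K x * f (u x) * u x)
      ≤ ∫ x, (K x * prim f (t * u x) - K x * prim f (u x)) := by
    refine integral_mono (hi1.const_mul _) (hi3.sub hi2) fun x => ?_
    have := mul_le_mul_of_nonneg_left (fiber_le hf hf4 (u x) ht) (h1.2.1 x).le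
    simp only
    linarith
  rw [integral_const_mul, integral_sub hi3 hi2, ← he] at h
  unfold Jfun
  rw [toReal_normSq_const_mul]
  linarith

theorem sSup_fiber_of_memNehari2
    (hα : 0 < α) (hN : 2 * α < N) (hV : Continuous V) (hK : Continuous K)
    (hf : Continuous f) (h1 : H1 V K) (h3 : H3 V K)
    (hf1 : Cf1 f) (hf2 : Cf2 f (critExp N α)) (hf4 : Cf4 f)
    {u : EN N → ℝ} (hu : memNehari2 α V K f u) :
    sSup {z : ℝ | ∃ t : ℝ, 0 < t ∧ z = Jfun α V K f (fun x => t * u x)} = Jfun α V K f u := by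
  refine IsGreatest.csSup_eq ⟨⟨1, one_pos, by simp⟩, ?_⟩
  rintro z ⟨t, ht, rfl⟩
  exact Jfun_const_mul_le_of_memNehari2 hα hN hV hK hf h1 h3 hf1 hf2 hf4 hu ht.le

theorem fiber_set_const_mul (u : EN N → ℝ) {s : ℝ} (hs : 0 < s) :
    {z : ℝ | ∃ t : ℝ, 0 < t ∧ z = Jfun α V K f (fun x => t * (s * u x))}
      = {z : ℝ | ∃ t : ℝ, 0 < t ∧ z = Jfun α V K f (fun x => t * u x)} := by
  ext z
  constructor
  · rintro ⟨t, ht, rfl⟩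
    exact ⟨t * s, mul_pos ht hs, by simp only [mul_assoc]⟩
  · rintro ⟨t, ht, rfl⟩
    refine ⟨t / s, div_pos ht hs, ?_⟩
    simp only [← mul_assoc, div_mul_cancel₀ t hs.ne']

/-- `J` is bounded below by a positive constant on the Nehari manifold. -/
theorem exists_pos_le_Jfun_of_memNehari2
    (hα : 0 < α) (hN : 2 * α < N) (hV : Continuous V) (hK : Continuous K)
    (hf : Continuous f) (h1 : H1 V K) (h3 : H3 V K)
    (hf1 : Cf1 f) (hf2 : Cf2 f (critExp N α)) (hf4 : Cf4 f) :
    ∃ δ : ℝ, 0 < δ ∧ ∀ u : EN N → ℝ, memNehari2 α V K f u → δ ≤ Jfun α V K f u := by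
  obtain ⟨ρ, hρ0, hρ⟩ := exists_sphere_integral_le hα hN hV hK hf h1 h3 hf1 hf2 hf4
  refine ⟨ρ / 4, by positivity, fun u hu => ?_⟩
  have hn := toReal_normSq_pos hV h1.1 hu.1 hu.2.1
  set n := (normSq α V u).toReal with hndef
  set t := √(ρ / n)
  have htn : (normSq α V fun x => t * u x).toReal = ρ := by
    rw [toReal_normSq_const_mul, ← hndef, Real.sq_sqrt (by positivity)]
    field_simp
  have hX := hu.1.const_mul t
  refine le_trans ?_ (Jfun_const_mul_le_of_memNehari2 hα hN hV hK hf h1 h3 hf1 hf2 hf4 hu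
    (Real.sqrt_nonneg (ρ / n)))
  have h := hρ _ hX htn
  have hle : ∫ x, K x * prim f (t * u x) ≤ ∫ x, 1 / 2 * (K x * f (t * u x) * (t * u x)) := by
    refine integral_mono (integrable_weight_mul_prim hα hN hV hK hf h1 h3 hf1 hf2 hf4 hX)
      ((integrable_weight_mul_self hα hN hV hK hf h1 h3 hf1 hf2 hf4 hX).const_mul _) fun x => ?_
    have := mul_le_mul_of_nonneg_left (two_mul_prim_le hf hf4 (t * u x)) (h1.2.1 x).le
    simp only
    linarith
  rw [integral_const_mul] at hle
  unfold Jfun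
  rw [htn]
  linarith

end Nehari

section Bump

variable {N : ℕ} {α : ℝ}

/-- The tent function supported in the unit ball. -/
def tent (x : EN N) : ℝ := max 0 (1 - ‖x‖)

theorem continuous_tent : Continuous (tent : EN N → ℝ) := by
  unfold tent; fun_prop

theorem tent_eq_zero {x : EN N} (hx : x ∉ Metric.closedBall (0 : EN N) 1) : tent x = 0 := by
  have : 1 < ‖x‖ := by simpa using hx
  exact max_eq_left (by linarith)

theorem sq_tent_sub_le (x y : EN N) : (tent x - tent y) ^ 2 ≤ min 1 (‖x - y‖ ^ 2) := by
  have h1 : |tent x - tent y| ≤ ‖x - y‖ := by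
    have h := abs_max_sub_max_le_max (0 : ℝ) (1 - ‖x‖) 0 (1 - ‖y‖)
    rw [sub_self, abs_zero, sub_sub_sub_cancel_left] at h
    rw [norm_sub_rev]
    exact h.trans (max_le (norm_nonneg _) (abs_norm_sub_norm_le y x))
  have hb : ∀ z : EN N, 0 ≤ tent z ∧ tent z ≤ 1 := fun z =>
    ⟨le_max_left _ _, max_le zero_le_one (by linarith [norm_nonneg z])⟩
  have h2 : |tent x - tent y| ≤ 1 := abs_le.2
    ⟨by linarith [(hb x).1, (hb y).2], by linarith [(hb x).2, (hb y).1]⟩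
  rw [← sq_abs]
  exact le_min (pow_le_one₀ (abs_nonneg _) h2) (pow_le_pow_left₀ (abs_nonneg _) h1 2)

theorem integrable_min_one_sq_div_rpow (hα : α ∈ Set.Ioo (0 : ℝ) 1) (hN : 0 < N) :
    Integrable fun z : EN N => min 1 (‖z‖ ^ 2) / ‖z‖ ^ ((N : ℝ) + 2 * α) := by
  obtain ⟨hα0, hα1⟩ := hα
  have : Nonempty (Fin N) := ⟨⟨0, hN⟩⟩
  have : Nontrivial (EN N) := inferInstance
  refine (integrable_fun_norm_addHaar (volume : Measure (EN N))
    (f := fun r => min 1 (r ^ 2) / r ^ ((N : ℝ) + 2 * α))).2 ?_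
  rw [finrank_euclideanSpace_fin, ← Set.Ioc_union_Ioi_eq_Ioi zero_le_one]
  have hpow : ∀ r : ℝ, 0 < r → r ^ (N - 1) = r ^ ((N : ℝ) - 1) := fun r hr => by
    rw [← Real.rpow_natCast, Nat.cast_sub hN, Nat.cast_one]
  refine IntegrableOn.union ?_ ?_
  · have hi : IntegrableOn (fun r : ℝ => r ^ (1 - 2 * α)) (Set.Ioc 0 1) :=
      (intervalIntegrable_iff_integrableOn_Ioc_of_le zero_le_one).1
        (intervalIntegral.intervalIntegrable_rpow' (by linarith))
    refine hi.congr_fun (fun r hr => ?_) measurableSet_Ioc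
    have hr0 := hr.1
    simp only [smul_eq_mul]
    rw [min_eq_right (pow_le_one₀ hr0.le hr.2), hpow r hr0, ← Real.rpow_natCast r 2,
      ← Real.rpow_sub hr0, ← Real.rpow_add hr0]
    congr 1; push_cast; ring
  · refine (integrableOn_Ioi_rpow_of_lt (a := -1 - 2 * α) (by linarith) one_pos).congr_fun
      (fun r hr => ?_) measurableSet_Ioi
    have hr1 : 1 < r := hr
    have hr0 : 0 < r := by linarith
    simp only [smul_eq_mul]
    rw [min_eq_left (one_le_pow₀ hr1.le), hpow r hr0, one_div, ← Real.rpow_neg hr0.le,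
      ← Real.rpow_add hr0]
    congr 1; ring

theorem gagSq_tent_lt_top (hα : α ∈ Set.Ioo (0 : ℝ) 1) (hN : 0 < N) :
    gagSq N α tent < ⊤ := by
  let φ : EN N → ENNReal := fun z => ENNReal.ofReal (min 1 (‖z‖ ^ 2) / ‖z‖ ^ ((N : ℝ) + 2 * α))
  let χ : EN N → ENNReal := (Metric.closedBall (0 : EN N) 1).indicator 1
  have hφm : Measurable φ := by fun_prop
  have hχm : Measurable χ := measurable_one.indicator Metric.isClosed_closedBall.measurableSet
  have hφ : ∫⁻ z, φ z < ⊤ := (integrable_min_one_sq_div_rpow hα hN).lintegral_lt_top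
  have hχ : ∫⁻ x, χ x < ⊤ := by
    rw [lintegral_indicator_one Metric.isClosed_closedBall.measurableSet]
    exact measure_closedBall_lt_top
  have hle : ∀ p : EN N × EN N,
      ENNReal.ofReal ((tent p.1 - tent p.2) ^ 2 / ‖p.1 - p.2‖ ^ ((N : ℝ) + 2 * α))
        ≤ χ p.1 * φ (p.1 - p.2) + χ p.2 * φ (p.1 - p.2) := by
    rintro ⟨x, y⟩
    have hmain : ENNReal.ofReal ((tent x - tent y) ^ 2 / ‖x - y‖ ^ ((N : ℝ) + 2 * α))
        ≤ φ (x - y) := ENNReal.ofReal_le_ofReal (by gcongr; exact sq_tent_sub_le x y)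
    by_cases hx : x ∈ Metric.closedBall (0 : EN N) 1
    · refine le_add_right (hmain.trans (le_of_eq ?_))
      simp [χ, Set.indicator_of_mem hx]
    by_cases hy : y ∈ Metric.closedBall (0 : EN N) 1
    · refine le_add_left (hmain.trans (le_of_eq ?_))
      simp [χ, Set.indicator_of_mem hy]
    · simp [tent_eq_zero hx, tent_eq_zero hy]
  have h1 : ∫⁻ p : EN N × EN N, χ p.1 * φ (p.1 - p.2) = (∫⁻ x, χ x) * ∫⁻ z, φ z := by
    rw [Measure.volume_eq_prod, lintegral_prod _ (by fun_prop), ← lintegral_mul_const _ hχm]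
    refine lintegral_congr fun x => ?_
    change ∫⁻ y, χ x * φ (x - y) = _
    rw [lintegral_const_mul _ (by fun_prop), lintegral_sub_left_eq_self φ x]
  have h2 : ∫⁻ p : EN N × EN N, χ p.2 * φ (p.1 - p.2) = (∫⁻ x, χ x) * ∫⁻ z, φ z := by
    rw [Measure.volume_eq_prod, lintegral_prod_symm _ (by fun_prop), ← lintegral_mul_const _ hχm]
    refine lintegral_congr fun y => ?_
    change ∫⁻ x, χ y * φ (x - y) = _
    rw [lintegral_const_mul _ (by fun_prop), lintegral_sub_right_eq_self φ y]
  have hfin := ENNReal.mul_lt_top hχ hφ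
  calc gagSq N α tent ≤ ∫⁻ p : EN N × EN N, (χ p.1 * φ (p.1 - p.2) + χ p.2 * φ (p.1 - p.2)) :=
        lintegral_mono hle
    _ < ⊤ := by
        rw [lintegral_add_left (by fun_prop), h1, h2]
        exact ENNReal.add_lt_top.2 ⟨hfin, hfin⟩

theorem memX_tent (hα : α ∈ Set.Ioo (0 : ℝ) 1) (hN : 0 < N) {V : EN N → ℝ} (hV : Continuous V) :
    memX α V tent := by
  refine ⟨continuous_tent.measurable, ENNReal.add_lt_top.2 ⟨gagSq_tent_lt_top hα hN, ?_⟩⟩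
  refine Integrable.lintegral_lt_top (Continuous.integrable_of_hasCompactSupport
    (hV.mul (continuous_tent.pow 2)) ?_)
  exact HasCompactSupport.intro (isCompact_closedBall (0 : EN N) 1) fun x hx => by
    simp [tent_eq_zero hx]

theorem notAEZero_tent : NotAEZero (tent : EN N → ℝ) := fun h => by
  have h0 := congrFun ((Continuous.ae_eq_iff_eq volume continuous_tent continuous_zero).1 h) 0
  simp [tent] at h0

end Bump

end ZeroMass

/-- Remark 3.3: `d_∞ = inf_N J = inf { sup_{t>0} J(tu) : u ∈ X \ {0} }` and `d_∞ > 0`. -/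
theorem statement14 {N : ℕ} (α : ℝ) (hα : α ∈ Set.Ioo (0 : ℝ) 1) (hN : 2 * α < N)
    (V K : EN N → ℝ) (f : ℝ → ℝ)
    (hV : Continuous V) (hK : Continuous K) (hf : Continuous f)
    (h1 : H1 V K) (h2 : H2 K) (h3 : H3 V K)
    (hf1 : Cf1 f) (hf2 : Cf2 f (critExp N α)) (hf3 : Cf3 f) (hf4 : Cf4 f) :
    sInf {y : ℝ | ∃ u : EN N → ℝ, memNehari2 α V K f u ∧ y = Jfun α V K f u} =
      sInf {y : ℝ | ∃ u : EN N → ℝ, memX α V u ∧ NotAEZero u ∧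
        y = sSup {z : ℝ | ∃ t : ℝ, 0 < t ∧ z = Jfun α V K f (fun x => t * u x)}} ∧
    0 < sInf {y : ℝ | ∃ u : EN N → ℝ, memNehari2 α V K f u ∧ y = Jfun α V K f u} := by
  obtain ⟨δ, hδ, hδJ⟩ := exists_pos_le_Jfun_of_memNehari2 hα.1 hN hV hK hf h1 h3 hf1 hf2 hf4
  have hN0 : 0 < N := by
    have : (0 : ℝ) < N := by linarith [hα.1]
    exact_mod_cast this
  refine ⟨congrArg sInf (Set.ext fun y => ⟨?_, ?_⟩), lt_of_lt_of_le hδ (le_csInf ?_ ?_)⟩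
  · rintro ⟨u, hu, rfl⟩
    exact ⟨u, hu.1, hu.2.1,
      (sSup_fiber_of_memNehari2 hα.1 hN hV hK hf h1 h3 hf1 hf2 hf4 hu).symm⟩
  · rintro ⟨u, hu, h0, rfl⟩
    obtain ⟨s, hs, hsu⟩ :=
      exists_memNehari2_const_mul hα.1 hN hV hK hf h1 h3 hf1 hf2 hf3 hf4 hu h0
    refine ⟨_, hsu, ?_⟩
    rw [← sSup_fiber_of_memNehari2 hα.1 hN hV hK hf h1 h3 hf1 hf2 hf4 hsu,
      fiber_set_const_mul u hs]
  · obtain ⟨s, -, hsu⟩ := exists_memNehari2_const_mul hα.1 hN hV hK hf h1 h3 hf1 hf2 hf3 hf4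
      (memX_tent hα hN0 hV) notAEZero_tent
    exact ⟨_, _, hsu, rfl⟩
  · rintro y ⟨u, hu, rfl⟩
    exact hδJ u hu
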